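/- arXiv:1510.08749 — 3 statements merged into one kernel-verified Lean document; each statement's English description precedes it below -/
import Mathlib

section
/- If G is a finite simple graph of maximum degree Δ(G) at least 3 and order n(G), then γ_e(G) ≥ (n(G)/(13(Δ(G)−1)^2))^{(log₂(Δ(G)−1)+1)/(log₂²(Δ(G)−1)+log₂(Δ(G)−1)+1)}, where the exponent is a real number and log₂ denotes the base-2 logarithm. -/
open SimpleGraph

/-- The contribution `(1/2)^(d-1)` of a vertex at `S`-restricted distance `d`,
with `(1/2)^∞ = 0`. -/
noncomputable def expStep (d : ℕ∞) : ℝ :=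
  if h : d = ⊤ then 0 else (1 / 2 : ℝ) ^ ((d.untop h : ℤ) - 1)

/-- `expDist G S u v` is the minimum number of edges of a walk in `G` from `u` to `v`
such that `v` is the only vertex of the walk belonging to `S` (i.e. the distance from `u`
to `v ∈ S` in `G - (S \ {v})`), and `⊤` if no such walk exists. -/
noncomputable def expDist {V : Type*} (G : SimpleGraph V) (S : Finset V) (u v : V) : ℕ∞ :=
  sInf {n : ℕ∞ | ∃ p : G.Walk u v, (∀ x ∈ p.support, x ∈ S → x = v) ∧ (p.length : ℕ∞) = n}

/-- The weight `w_{(G,S)}(u) = Σ_{v ∈ S} (1/2)^(dist_{(G,S)}(u,v) - 1)`. -/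
noncomputable def expWeight {V : Type*} (G : SimpleGraph V) (S : Finset V) (u : V) : ℝ :=
  ∑ v ∈ S, expStep (expDist G S u v)

/-- `S` is an exponential dominating set of `G`. -/
def IsExpDomSet {V : Type*} (G : SimpleGraph V) (S : Finset V) : Prop :=
  ∀ u : V, 1 ≤ expWeight G S u

/-- The exponential domination number of `G`. -/
noncomputable def expDomNum {V : Type*} (G : SimpleGraph V) : ℕ :=
  sInf {k : ℕ | ∃ S : Finset V, IsExpDomSet G S ∧ S.card = k}

theorem expStep_coe (d : ℕ) : expStep (d : ℕ∞) = 2 * (1 / 2 : ℝ) ^ d := by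
  have h : (d : ℕ∞) ≠ ⊤ := ENat.natCast_ne_top d
  have hd : ((d : ℕ∞).untop h) = d := WithTop.untop_coe d
  rw [expStep, dif_neg h, hd, zpow_sub₀ (by norm_num)]
  norm_num
  ring

/-- A contribution is at most `(1/2)^D` unless it comes from a distance at most `D`. -/
theorem expStep_le (e : ℕ∞) (D : ℕ) :
    expStep e ≤ (1 / 2 : ℝ) ^ D +
      ∑ d ∈ Finset.range (D + 1), if e = (d : ℕ∞) then 2 * (1 / 2 : ℝ) ^ d else 0 := by
  have hpos : (0 : ℝ) ≤ ∑ d ∈ Finset.range (D + 1),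
      if e = (d : ℕ∞) then 2 * (1 / 2 : ℝ) ^ d else 0 :=
    Finset.sum_nonneg fun d _ => by split_ifs <;> positivity
  have hD : (0 : ℝ) < (1 / 2 : ℝ) ^ D := by positivity
  induction e using ENat.recTopCoe with
  | top =>
    have h : expStep ⊤ = 0 := by simp [expStep]
    linarith
  | coe m =>
    rw [expStep_coe]
    by_cases hm : m ≤ D
    · have h := Finset.single_le_sum
        (f := fun d : ℕ => if (m : ℕ∞) = (d : ℕ∞) then 2 * (1 / 2 : ℝ) ^ d else 0)
        (fun d _ => by split_ifs <;> positivity) (Finset.mem_range.2 (Nat.lt_succ_of_le hm))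
      simp only [if_true] at h
      linarith
    · have h : (1 / 2 : ℝ) ^ m ≤ (1 / 2) ^ (D + 1) :=
        pow_le_pow_of_le_one (by norm_num) (by norm_num) (by omega)
      rw [pow_succ] at h
      linarith

section

variable {V : Type*} (G : SimpleGraph V) (S : Finset V)

theorem expDist_le {u v : V} (p : G.Walk u v) (hp : ∀ x ∈ p.support, x ∈ S → x = v) :
    expDist G S u v ≤ p.length :=
  sInf_le ⟨p, hp, rfl⟩

theorem exists_walk_of_expDist_eq {u v : V} {d : ℕ} (h : expDist G S u v = d) :
    ∃ p : G.Walk u v, (∀ x ∈ p.support, x ∈ S → x = v) ∧ p.length = d := by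
  have hne : {n : ℕ∞ | ∃ p : G.Walk u v,
      (∀ x ∈ p.support, x ∈ S → x = v) ∧ (p.length : ℕ∞) = n}.Nonempty := by
    by_contra hne
    rw [Set.not_nonempty_iff_eq_empty] at hne
    rw [expDist, hne, sInf_empty] at h
    exact ENat.natCast_ne_top d h.symm
  obtain ⟨p, hp, hl⟩ := csInf_mem hne
  refine ⟨p, hp, ?_⟩
  replace hl := hl.trans h
  exact_mod_cast hl

theorem expDist_self (v : V) : expDist G S v v = 0 := by
  have h := expDist_le G S (SimpleGraph.Walk.nil : G.Walk v v) (by simp)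
  simpa using h

theorem eq_of_expDist_eq_zero {u v : V} (h : expDist G S u v = 0) : u = v := by
  obtain ⟨p, -, hl⟩ := exists_walk_of_expDist_eq G S (d := 0) (by simpa using h)
  exact SimpleGraph.Walk.eq_of_length_eq_zero hl

theorem exists_adj_expDist_eq {u v : V} {d : ℕ} (h : expDist G S u v = (d + 1 : ℕ)) :
    ∃ w, G.Adj u w ∧ expDist G S w v = d := by
  obtain ⟨p, hp, hl⟩ := exists_walk_of_expDist_eq G S h
  cases p with
  | nil => simp at hl
  | cons hadj p =>
    rename_i w
    refine ⟨w, hadj, ?_⟩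
    have hle := expDist_le G S p fun x hx => hp x (by simp [hx])
    have hl' : p.length = d := by simpa using hl
    rw [hl'] at hle
    obtain ⟨m, hm⟩ := ENat.ne_top_iff_exists.1 (ne_top_of_le_ne_top (ENat.natCast_ne_top d) hle)
    obtain ⟨r, hr, hrl⟩ := exists_walk_of_expDist_eq G S hm.symm
    have hle' := expDist_le G S (SimpleGraph.Walk.cons hadj r) (by
      intro x hx
      rcases List.mem_cons.1 (by simpa using hx) with rfl | hx
      · exact hp x (by simp)
      · exact hr x hx)
    rw [h, SimpleGraph.Walk.length_cons, hrl] at hle'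
    rw [← hm] at hle ⊢
    norm_cast at hle hle' ⊢
    omega

variable [Fintype V]

theorem isExpDomSet_univ : IsExpDomSet G (Finset.univ : Finset V) := by
  intro u
  have hnn : ∀ e, 0 ≤ expStep e := fun e => by
    unfold expStep
    split_ifs <;> positivity
  have h := Finset.single_le_sum (f := fun v => expStep (expDist G Finset.univ u v))
    (fun v _ => hnn _) (Finset.mem_univ u)
  have h0 : expStep 0 = 2 := by simpa using expStep_coe 0
  simp only [expDist_self, h0] at h
  unfold expWeight
  linarith

theorem exists_isExpDomSet_card_eq : ∃ S, IsExpDomSet G S ∧ S.card = expDomNum G :=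
  Nat.sInf_mem (s := {k : ℕ | ∃ S : Finset V, IsExpDomSet G S ∧ S.card = k})
    ⟨_, Finset.univ, isExpDomSet_univ G, rfl⟩

variable [DecidableRel G.Adj]

open Classical in
/-- Spheres around `v` for the restricted distance grow by a factor less than the
maximum degree. -/
theorem card_expDist_eq_le {q : ℕ} (hq : G.maxDegree = q + 1) (v : V) (d : ℕ) :
    (Finset.univ.filter fun u => expDist G S u v = (d + 1 : ℕ)).card ≤ (q + 1) * q ^ d := by
  induction d with
  | zero =>
    have hsub : (Finset.univ.filter fun u => expDist G S u v = (0 + 1 : ℕ)) ⊆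
        G.neighborFinset v := by
      intro u hu
      obtain ⟨w, hw, hd⟩ := exists_adj_expDist_eq G S (Finset.mem_filter.1 hu).2
      obtain rfl := eq_of_expDist_eq_zero G S (by simpa using hd)
      exact (G.mem_neighborFinset _ _).2 hw.symm
    calc _ ≤ (G.neighborFinset v).card := Finset.card_le_card hsub
      _ ≤ q + 1 := by
        rw [SimpleGraph.card_neighborFinset_eq_degree, ← hq]
        exact G.degree_le_maxDegree v
      _ = _ := by simp
  | succ d ih =>
    set A := Finset.univ.filter fun u => expDist G S u v = (d + 1 : ℕ)
    set B := Finset.univ.filter fun u => expDist G S u v = (d + 1 + 1 : ℕ)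
    have hsub : B ⊆ A.biUnion fun w => B ∩ G.neighborFinset w := by
      intro u hu
      obtain ⟨w, hw, hd⟩ := exists_adj_expDist_eq G S (Finset.mem_filter.1 hu).2
      simp only [Finset.mem_biUnion, Finset.mem_inter, SimpleGraph.mem_neighborFinset]
      exact ⟨w, Finset.mem_filter.2 ⟨Finset.mem_univ _, hd⟩, hu, hw.symm⟩
    have hcard : ∀ w ∈ A, (B ∩ G.neighborFinset w).card ≤ q := by
      intro w hw
      obtain ⟨y, hy, hd⟩ := exists_adj_expDist_eq G S (Finset.mem_filter.1 hw).2
      have hss : B ∩ G.neighborFinset w ⊆ (G.neighborFinset w).erase y := by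
        intro u hu
        rw [Finset.mem_inter] at hu
        refine Finset.mem_erase.2 ⟨?_, hu.2⟩
        rintro rfl
        have h := (Finset.mem_filter.1 hu.1).2
        rw [hd] at h
        norm_cast at h
        omega
      have hy' : y ∈ G.neighborFinset w := by simpa using hy
      have h1 := Finset.card_le_card hss
      rw [Finset.card_erase_of_mem hy', SimpleGraph.card_neighborFinset_eq_degree] at h1
      have h2 := G.degree_le_maxDegree w
      omega
    calc B.card ≤ _ := Finset.card_le_card hsub
      _ ≤ A.card * q := Finset.card_biUnion_le_card_mul _ _ _ hcard
      _ ≤ (q + 1) * q ^ d * q := Nat.mul_le_mul_right _ ih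
      _ = _ := by ring

theorem sum_expStep_le {q : ℕ} (hq : G.maxDegree = q + 1) (v : V) (D : ℕ) :
    ∑ u, expStep (expDist G S u v) ≤ Fintype.card V * (1 / 2 : ℝ) ^ D +
      (2 + (q + 1) * ∑ d ∈ Finset.range D, ((q : ℝ) / 2) ^ d) := by
  classical
  have h0 : (Finset.univ.filter fun u => expDist G S u v = (0 : ℕ)).card ≤ 1 := by
    refine Finset.card_le_one.2 fun a ha b hb => ?_
    have ha := eq_of_expDist_eq_zero G S (by simpa using ha)
    have hb := eq_of_expDist_eq_zero G S (by simpa using hb)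
    rw [ha, hb]
  calc ∑ u, expStep (expDist G S u v)
      ≤ ∑ u, ((1 / 2 : ℝ) ^ D + ∑ d ∈ Finset.range (D + 1),
          if expDist G S u v = (d : ℕ∞) then 2 * (1 / 2 : ℝ) ^ d else 0) :=
        Finset.sum_le_sum fun u _ => expStep_le _ _
    _ = Fintype.card V * (1 / 2 : ℝ) ^ D + ∑ d ∈ Finset.range (D + 1),
          ((Finset.univ.filter fun u => expDist G S u v = (d : ℕ)).card : ℝ) *
            (2 * (1 / 2 : ℝ) ^ d) := by
        rw [Finset.sum_add_distrib, Finset.sum_comm]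
        congr 1
        · simp
        · refine Finset.sum_congr rfl fun d _ => ?_
          rw [← Finset.sum_filter, Finset.sum_const, nsmul_eq_mul]
    _ ≤ _ := by
        rw [Finset.sum_range_succ', Finset.mul_sum, add_comm (2 : ℝ)]
        refine add_le_add le_rfl (add_le_add (Finset.sum_le_sum fun d _ => ?_) ?_)
        · have h : ((Finset.univ.filter fun u => expDist G S u v = (d + 1 : ℕ)).card : ℝ) ≤
              (q + 1) * q ^ d := by exact_mod_cast card_expDist_eq_le G S hq v d
          calc _ ≤ ((q + 1) * (q : ℝ) ^ d) * (2 * (1 / 2 : ℝ) ^ (d + 1)) := by gcongr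
            _ = _ := by rw [div_pow (q : ℝ), pow_succ, one_div, inv_pow]; ring
        · have h : ((Finset.univ.filter fun u => expDist G S u v = (0 : ℕ)).card : ℝ) ≤ 1 := by
            exact_mod_cast h0
          simp only [pow_zero]
          linarith

variable {S} in
theorem IsExpDomSet.card_le {q : ℕ} (hS : IsExpDomSet G S) (hq : G.maxDegree = q + 1) (D : ℕ) :
    (Fintype.card V : ℝ) ≤ S.card * (Fintype.card V * (1 / 2 : ℝ) ^ D +
      (2 + (q + 1) * ∑ d ∈ Finset.range D, ((q : ℝ) / 2) ^ d)) := by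
  calc (Fintype.card V : ℝ) = ∑ _u : V, (1 : ℝ) := by simp
    _ ≤ ∑ u, expWeight G S u := Finset.sum_le_sum fun u _ => hS u
    _ = ∑ v ∈ S, ∑ u, expStep (expDist G S u v) := by
        simp only [expWeight]
        rw [Finset.sum_comm]
    _ ≤ ∑ _v ∈ S, _ := Finset.sum_le_sum fun v _ => sum_expStep_le G S hq v D
    _ = _ := by rw [Finset.sum_const, nsmul_eq_mul]

end

theorem sq_eight_add_three_mul_le (m : ℕ) : (8 + 3 * m) ^ 2 ≤ 676 * 2 ^ m := by
  induction m with
  | zero => norm_num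
  | succ m ih =>
    have h : (8 + 3 * (m + 1)) ^ 2 ≤ (8 + 3 * m) ^ 2 * 2 := by
      nlinarith [Nat.zero_le (m ^ 2), Nat.zero_le m]
    calc (8 + 3 * (m + 1)) ^ 2 ≤ (8 + 3 * m) ^ 2 * 2 := h
      _ ≤ 676 * 2 ^ m * 2 := Nat.mul_le_mul_right _ ih
      _ = 676 * 2 ^ (m + 1) := by ring

/-- The numerical estimate obtained by cutting off the weights at distance `log₂ k + 2`. -/
theorem le_thirteen_mul_rpow {n : ℝ} {k q : ℕ} (hk : 1 ≤ k) (hq : 2 ≤ q) (hn : 0 ≤ n)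
    (h : ∀ D : ℕ, n ≤ k * (n * (1 / 2 : ℝ) ^ D +
      (2 + (q + 1) * ∑ d ∈ Finset.range D, ((q : ℝ) / 2) ^ d))) :
    n ≤ 13 * (q : ℝ) ^ 2 *
      (k : ℝ) ^ (Real.logb 2 q + 1 / (Real.logb 2 q + 1)) := by
  set m := Nat.log 2 k
  have hk' : (1 : ℝ) ≤ k := by exact_mod_cast hk
  have hq' : (2 : ℝ) ≤ q := by exact_mod_cast hq
  have hm1 : (2 : ℝ) ^ m ≤ k := by exact_mod_cast Nat.pow_log_le_self 2 (by omega)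
  have hm2 : (k : ℝ) ≤ 2 ^ m * 2 := by
    have := (Nat.lt_pow_succ_log_self (b := 2) (by norm_num) k).le
    rw [Nat.succ_eq_add_one, pow_succ] at this
    exact_mod_cast this
  have hD : (k : ℝ) * (1 / 2 : ℝ) ^ (m + 2) ≤ 1 / 2 := by
    rw [one_div, inv_pow, ← div_eq_mul_inv, div_le_iff₀ (by positivity), pow_add]
    linarith
  have hmain : n ≤ 2 * k * (2 + (q + 1) * ∑ d ∈ Finset.range (m + 2), ((q : ℝ) / 2) ^ d) := by
    nlinarith [h (m + 2), mul_le_mul_of_nonneg_left hD hn]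
  rcases hq.eq_or_lt with rfl | hq3
  · have hexp : Real.logb 2 ((2 : ℕ) : ℝ) + 1 / (Real.logb 2 ((2 : ℕ) : ℝ) + 1) = 1 + 1 / 2 := by
      rw [Nat.cast_ofNat, Real.logb_self_eq_one (by norm_num)]
      norm_num
    have hs : (8 + 3 * (m : ℝ)) ≤ 26 * √k := by
      refine le_of_sq_le_sq ?_ (by positivity)
      rw [mul_pow, Real.sq_sqrt (by positivity)]
      have : (8 + 3 * (m : ℝ)) ^ 2 ≤ 676 * 2 ^ m := by
        exact_mod_cast sq_eight_add_three_mul_le m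
      linarith
    rw [hexp, Real.rpow_add (by positivity), Real.rpow_one, ← Real.sqrt_eq_rpow]
    norm_num at hmain ⊢
    nlinarith [mul_le_mul_of_nonneg_left hs (by positivity : (0 : ℝ) ≤ k)]
  · have hq3' : (3 : ℝ) ≤ q := by exact_mod_cast hq3
    set L := Real.logb 2 q with hL
    have h2L : (2 : ℝ) ^ L = q := Real.rpow_logb (by norm_num) (by norm_num) (by linarith)
    have hL1 : 1 ≤ L := by
      rw [hL, Real.le_logb_iff_rpow_le (by norm_num) (by linarith)]
      simpa using hq'
    have hqm : (q : ℝ) ^ m ≤ (k : ℝ) ^ L := by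
      rw [← h2L, ← Real.rpow_mul_natCast (by norm_num), mul_comm, Real.rpow_natCast_mul (by norm_num)]
      gcongr
    have hgeom : (q + 1) * ∑ d ∈ Finset.range (m + 2), ((q : ℝ) / 2) ^ d ≤
        8 * ((q : ℝ) / 2) ^ (m + 2) := by
      have hg := geom_sum_mul ((q : ℝ) / 2) (m + 2)
      have hnn : 0 ≤ ∑ d ∈ Finset.range (m + 2), ((q : ℝ) / 2) ^ d :=
        Finset.sum_nonneg fun _ _ => by positivity
      nlinarith [mul_nonneg hnn (by linarith : (0 : ℝ) ≤ 3 * q - 9)]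
    have hkq : (k : ℝ) * ((q : ℝ) / 2) ^ (m + 2) ≤ q ^ 2 * (k : ℝ) ^ L / 2 := by
      calc (k : ℝ) * ((q : ℝ) / 2) ^ (m + 2)
          = (k * (1 / 2 : ℝ) ^ (m + 2)) * (q ^ 2 * q ^ m) := by
            rw [div_pow, one_div, inv_pow]; ring
        _ ≤ (1 / 2) * (q ^ 2 * (k : ℝ) ^ L) := by gcongr
        _ = _ := by ring
    have hkL : (k : ℝ) ≤ (k : ℝ) ^ L := by
      simpa using Real.rpow_le_rpow_of_exponent_le hk' hL1
    have hkx : (k : ℝ) ^ L ≤ (k : ℝ) ^ (L + 1 / (L + 1)) :=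
      Real.rpow_le_rpow_of_exponent_le hk' (by
        have : 0 ≤ 1 / (L + 1) := by positivity
        linarith)
    calc n ≤ 4 * k + 2 * (k * (8 * ((q : ℝ) / 2) ^ (m + 2))) := by
          have := mul_le_mul_of_nonneg_left hgeom (by positivity : (0 : ℝ) ≤ k)
          linarith
      _ ≤ 4 * (k : ℝ) ^ L + 8 * (q ^ 2 * (k : ℝ) ^ L) := by linarith
      _ ≤ 13 * (q : ℝ) ^ 2 * (k : ℝ) ^ L := by
          have : 0 ≤ (k : ℝ) ^ L := by positivity
          nlinarith [mul_nonneg this (by nlinarith : (0 : ℝ) ≤ (q : ℝ) ^ 2 - 9)]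
      _ ≤ _ := by gcongr

/-- Theorem 2: if `G` has maximum degree `Δ ≥ 3` and order `n`, then
`γ_e(G) ≥ (n / (13(Δ-1)²)) ^ ((log₂(Δ-1)+1)/(log₂²(Δ-1)+log₂(Δ-1)+1))`. -/
theorem expDomNum_polynomial_lower_bound {V : Type*} [Fintype V]
    (G : SimpleGraph V) [DecidableRel G.Adj] (hΔ : 3 ≤ G.maxDegree) :
    ((Fintype.card V : ℝ) / (13 * ((G.maxDegree : ℝ) - 1) ^ 2)) ^
        ((Real.logb 2 ((G.maxDegree : ℝ) - 1) + 1) /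
          ((Real.logb 2 ((G.maxDegree : ℝ) - 1)) ^ 2 +
            Real.logb 2 ((G.maxDegree : ℝ) - 1) + 1))
      ≤ (expDomNum G : ℝ) := by
  obtain ⟨q, hq⟩ : ∃ q, G.maxDegree = q + 1 := ⟨G.maxDegree - 1, by omega⟩
  obtain ⟨S, hS, hcard⟩ := exists_isExpDomSet_card_eq G
  have hq2 : 2 ≤ q := by omega
  have hq' : (2 : ℝ) ≤ q := by exact_mod_cast hq2
  have hqr : (G.maxDegree : ℝ) - 1 = q := by rw [hq]; push_cast; ring
  have hk : 1 ≤ S.card := by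
    by_contra hk
    obtain rfl : S = ∅ := by simpa using hk
    have : IsEmpty V := ⟨fun u => absurd (hS u) (by simp [expWeight])⟩
    simp at hΔ
  have hbound := le_thirteen_mul_rpow hk hq2 (Nat.cast_nonneg _) (hS.card_le G hq)
  rw [hqr, ← hcard]
  set L := Real.logb 2 q with hL
  have hL0 : 0 < L := Real.logb_pos (by norm_num) (by linarith)
  have hexp : (L + 1) / (L ^ 2 + L + 1) = (L + 1 / (L + 1))⁻¹ := by
    field_simp
  rw [hexp, Real.rpow_inv_le_iff_of_pos (by positivity) (by positivity) (by positivity),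
    div_le_iff₀' (by positivity)]
  exact hbound
end

section
/- If G is a finite connected simple graph of radius rad(G) at least 1, then γ_e(G) ≤ 2^{2·rad(G) − 2}. -/
open SimpleGraph

/-- The radius of a finite graph: the minimum over all vertices `v` of the
eccentricity of `v` (the maximum distance from `v` to any vertex). -/
noncomputable def graphRadius {V : Type*} [Fintype V] (G : SimpleGraph V) : ℕ :=
  sInf {e : ℕ | ∃ v : V, e = Finset.univ.sup fun u => G.dist v u}

theorem expStep_nonneg (d : ℕ∞) : 0 ≤ expStep d := by
  unfold expStep
  split_ifs <;> positivity

theorem le_expStep {d : ℕ∞} {n : ℕ} (h : d ≤ (n + 1 : ℕ)) : (1 / 2 : ℝ) ^ n ≤ expStep d := by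
  lift d to ℕ using ne_top_of_le_ne_top (ENat.natCast_ne_top _) h
  have hd : d ≤ n + 1 := by exact_mod_cast h
  rw [expStep, dif_neg (ENat.natCast_ne_top d), ← zpow_natCast]
  refine zpow_le_zpow_right_of_le_one₀ (by norm_num) (by norm_num) ?_
  change (d : ℤ) - 1 ≤ n
  omega

section

variable {V : Type*} {G : SimpleGraph V}

theorem expDist_le_length {S : Finset V} {u v : V} (p : G.Walk u v)
    (hp : ∀ x ∈ p.support, x ∈ S → x = v) : expDist G S u v ≤ p.length :=
  sInf_le ⟨p, hp, rfl⟩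

theorem card_mul_le_expWeight {S T : Finset V} {u : V} {n : ℕ} (hTS : T ⊆ S)
    (h : ∀ v ∈ T, ∃ p : G.Walk u v, (∀ x ∈ p.support, x ∈ S → x = v) ∧ p.length ≤ n + 1) :
    (T.card : ℝ) * (1 / 2) ^ n ≤ expWeight G S u := by
  calc (T.card : ℝ) * (1 / 2) ^ n = ∑ _v ∈ T, (1 / 2 : ℝ) ^ n := by simp
    _ ≤ ∑ v ∈ T, expStep (expDist G S u v) := by
        refine Finset.sum_le_sum fun v hv => ?_
        obtain ⟨p, hp, hl⟩ := h v hv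
        exact le_expStep ((expDist_le_length p hp).trans (by exact_mod_cast hl))
    _ ≤ expWeight G S u :=
        Finset.sum_le_sum_of_subset_of_nonneg hTS fun _ _ _ => expStep_nonneg _

theorem one_le_expWeight_of_mem {S : Finset V} {u : V} (hu : u ∈ S) : 1 ≤ expWeight G S u := by
  have := card_mul_le_expWeight (G := G) (S := S) (T := {u}) (u := u) (n := 0) (by simpa)
    (by simp only [Finset.mem_singleton, forall_eq]; exact ⟨.nil, by simp, by simp⟩)
  simpa using this

theorem one_le_expWeight_of_dist_le_one (hG : G.Connected) {S : Finset V} {u v : V} (hv : v ∈ S)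
    (huv : G.dist u v ≤ 1) : 1 ≤ expWeight G S u := by
  by_cases hu : u ∈ S
  · exact one_le_expWeight_of_mem hu
  have hadj : G.Adj u v := by
    rw [← dist_eq_one_iff_adj]
    have : G.dist u v ≠ 0 := fun h => hu ((hG.dist_eq_zero_iff.1 h) ▸ hv)
    omega
  have := card_mul_le_expWeight (G := G) (S := S) (T := {v}) (u := u) (n := 0) (by simpa)
    (by
      simp only [Finset.mem_singleton, forall_eq]
      refine ⟨hadj.toWalk, ?_, by simp⟩
      intro x hx hxS
      simp only [Adj.toWalk, Walk.support_cons, Walk.support_nil, List.mem_cons,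
        List.not_mem_nil, or_false] at hx
      rcases hx with rfl | rfl
      · exact absurd hxS hu
      · rfl)
  simpa using this

theorem SimpleGraph.Walk.dist_add_dist_le_length {u v x : V} (p : G.Walk u v)
    (hx : x ∈ p.support) : G.dist u x + G.dist x v ≤ p.length := by
  classical
  rw [← p.take_spec hx, Walk.length_append]
  exact add_le_add (dist_le _) (dist_le _)

/-- A large set `T` of vertices at distance `k` from `c` dominates every vertex at distance at
most `k + 1` from `c`, when the other vertices of `S` are further away. -/
theorem one_le_expWeight_of_level (hG : G.Connected) {S T : Finset V} {c u : V} {k n : ℕ}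
    (hTS : T ⊆ S) (hT : ∀ v ∈ T, G.dist c v = k) (hS : ∀ x ∈ S, x ∉ T → k + 1 < G.dist c x)
    (hu : G.dist c u ≤ k + 1) (hn : G.dist c u + k ≤ n + 1)
    (hcard : 1 ≤ (T.card : ℝ) * (1 / 2) ^ n) : 1 ≤ expWeight G S u := by
  by_cases hnear : ∃ x ∈ S, G.dist u x ≤ 1
  · obtain ⟨x, hx, hux⟩ := hnear
    exact one_le_expWeight_of_dist_le_one hG hx hux
  push Not at hnear
  refine hcard.trans (card_mul_le_expWeight hTS fun v hv => ?_)
  obtain ⟨p, hp⟩ := hG.exists_walk_length_eq_dist u c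
  obtain ⟨q, hq⟩ := hG.exists_walk_length_eq_dist c v
  have huc : G.dist u c = G.dist c u := SimpleGraph.dist_comm
  have hvk := hT v hv
  refine ⟨p.append q, fun x hx hxS => ?_, by rw [Walk.length_append]; omega⟩
  have hxk : G.dist c x ≤ k + 1 → G.dist c x = k := fun h =>
    hT x (by_contra fun hxT => (hS x hxS hxT).not_ge h)
  rcases (Walk.mem_support_append_iff _ _).1 hx with hx | hx
  · have := p.dist_add_dist_le_length hx
    have hxc : G.dist x c = G.dist c x := SimpleGraph.dist_comm
    have := hnear x hxS
    omega
  · have := q.dist_add_dist_le_length hx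
    have := hxk (by omega)
    exact hG.dist_eq_zero_iff.1 (by omega)

theorem exists_dominating_ball [Fintype V] [DecidableEq V] (hG : G.Connected) (c : V) (r : ℕ) :
    ∃ S : Finset V, S.card ≤ 4 ^ (r - 1) ∧ ∀ A : Finset V, (∀ x ∈ A, r < G.dist c x) →
      ∀ u, G.dist c u ≤ r → 1 ≤ expWeight G (S ∪ A) u := by
  have small : ∀ r ≤ 1, ∀ A : Finset V, ∀ u, G.dist c u ≤ r →
      1 ≤ expWeight G ({c} ∪ A) u := fun r hr A u hu =>
    one_le_expWeight_of_dist_le_one hG (v := c) (by simp) (by rw [SimpleGraph.dist_comm]; omega)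
  induction r using Nat.twoStepInduction with
  | zero => exact ⟨{c}, by simp, fun A _ => small 0 (by omega) A⟩
  | one => exact ⟨{c}, by simp, fun A _ => small 1 le_rfl A⟩
  | more j ih _ =>
    obtain ⟨S, hS, hdom⟩ := ih
    set L : Finset V := Finset.univ.filter fun v => G.dist c v = j + 1 with hLdef
    have hL : ∀ v, v ∈ L ↔ G.dist c v = j + 1 := by simp [hLdef]
    have hpow : ∀ m : ℕ, (4 : ℝ) ^ m * (1 / 2) ^ (2 * m) = 1 := fun m => by
      rw [pow_mul, ← mul_pow]; norm_num
    have level : ∀ (T A : Finset V) (m : ℕ) (u : V), T ⊆ L → 4 ^ m ≤ T.card →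
        (∀ x ∈ A, j + 2 < G.dist c x) → G.dist c u ≤ j + 2 → G.dist c u + j ≤ 2 * m →
        1 ≤ expWeight G (T ∪ A) u := by
      intro T A m u hTL hm hA hu hum
      refine one_le_expWeight_of_level hG (n := 2 * m) Finset.subset_union_left
        (fun v hv => (hL v).1 (hTL hv)) (fun x hx hxT => hA x ?_) hu (by omega) ?_
      · exact (Finset.mem_union.1 hx).resolve_left hxT
      · refine (hpow m).ge.trans (mul_le_mul_of_nonneg_right ?_ (by positivity))
        exact_mod_cast hm
    rcases le_or_gt (4 ^ (j + 1)) L.card with hbig | hsmall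
    · obtain ⟨T, hTL, hT⟩ := Finset.exists_subset_card_eq hbig
      exact ⟨T, hT.le, fun A hA u hu => level T A (j + 1) u hTL hT.ge hA hu (by omega)⟩
    have outer : ∀ (S : Finset V) (u : V), L ⊆ S → j < G.dist c u → G.dist c u ≤ j + 2 →
        1 ≤ expWeight G S u := by
      intro S u hLS hju hu
      rcases Nat.lt_or_ge (j + 1) (G.dist c u) with h | h
      · obtain ⟨p, hp⟩ := hG.exists_walk_length_eq_dist c u
        have h1 : G.dist c (p.getVert (j + 1)) ≤ j + 1 :=
          (dist_le (p.take (j + 1))).trans (by simp [Walk.take_length])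
        have h2 : G.dist (p.getVert (j + 1)) u ≤ 1 :=
          (dist_le (p.drop (j + 1))).trans (by rw [Walk.drop_length]; omega)
        have h3 := hG.dist_triangle (u := c) (v := p.getVert (j + 1)) (w := u)
        exact one_le_expWeight_of_dist_le_one hG (v := p.getVert (j + 1)) (hLS ((hL _).2 (by omega)))
          (by rwa [SimpleGraph.dist_comm])
      · exact one_le_expWeight_of_mem (hLS ((hL u).2 (by omega)))
    rcases le_or_gt (4 ^ j) L.card with hmid | htiny
    · refine ⟨L, hsmall.le, fun A hA u hu => ?_⟩
      rcases Nat.lt_or_ge j (G.dist c u) with h | h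
      · exact outer _ u Finset.subset_union_left h hu
      · exact level L A j u subset_rfl hmid hA hu (by omega)
    · refine ⟨S ∪ L, ?_, fun A hA u hu => ?_⟩
      · have h1 : 4 ^ (j - 1) ≤ 4 ^ j := Nat.pow_le_pow_right (by norm_num) (by omega)
        have h2 := Finset.card_union_le S L
        have h3 : 4 ^ (j + 2 - 1) = 4 * 4 ^ j := by
          rw [show j + 2 - 1 = j + 1 by omega, pow_succ']
        omega
      · rw [Finset.union_assoc]
        rcases Nat.lt_or_ge j (G.dist c u) with h | h
        · exact outer _ u
            (Finset.subset_union_left.trans Finset.subset_union_right) h hu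
        · refine hdom _ (fun x hx => ?_) u h
          rcases Finset.mem_union.1 hx with hx | hx
          · have := (hL x).1 hx
            omega
          · have := hA x hx
            omega

end

/-- Theorem 3: if `G` is a connected graph of radius `rad(G) ≥ 1`, then
`γ_e(G) ≤ 2^(2 rad(G) - 2)`. -/
theorem expDomNum_le_radius_bound {V : Type*} [Fintype V]
    (G : SimpleGraph V) (hG : G.Connected) (hr : 1 ≤ graphRadius G) :
    expDomNum G ≤ 2 ^ (2 * graphRadius G - 2) := by
  classical
  obtain ⟨v₀⟩ := hG.nonempty
  obtain ⟨c, hc⟩ : graphRadius G ∈ {e : ℕ | ∃ v : V, e = Finset.univ.sup fun u => G.dist v u} :=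
    Nat.sInf_mem ⟨_, v₀, rfl⟩
  obtain ⟨S, hS, hdom⟩ := exists_dominating_ball hG c (graphRadius G)
  have hSdom : IsExpDomSet G S := fun u => by
    have hu : G.dist c u ≤ graphRadius G := by
      rw [hc]
      exact Finset.le_sup (f := fun u => G.dist c u) (Finset.mem_univ u)
    simpa using hdom ∅ (by simp) u hu
  calc expDomNum G ≤ S.card := Nat.sInf_le ⟨S, hSdom, rfl⟩
    _ ≤ 4 ^ (graphRadius G - 1) := hS
    _ = 2 ^ (2 * graphRadius G - 2) := by
      rw [show 2 * graphRadius G - 2 = 2 * (graphRadius G - 1) by omega, pow_mul]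
      norm_num
end

section
/- Let T be a binary rooted tree with root r and let S be a set of vertices of T. Then w_{(T,S)}(r) = 2 if and only if T contains a full binary subtree F with root r such that V(F) ∩ S is exactly the set of leaves of F; here F is a subtree of T rooted at r in which the children of each vertex of F are among its children in T, every non-leaf vertex of F has exactly two children in F, and a leaf of F is a vertex of F with no children in F. -/
open SimpleGraph

theorem expStep_natCast (n : ℕ) : expStep (n : ℕ∞) = 2 * (1 / 2 : ℝ) ^ n := by
  have h : (n : ℕ∞) ≠ ⊤ := ENat.natCast_ne_top n
  have h2 : (n : ℕ∞).untop h = n := rfl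
  rw [expStep, dif_neg h, h2, zpow_sub₀ (by norm_num)]
  norm_num
  ring

/-- `v` can be reached from `u` by a walk that meets `S` at most in `v`. -/
def ExpReach {V : Type*} (G : SimpleGraph V) (S : Finset V) (u v : V) : Prop :=
  ∃ p : G.Walk u v, ∀ x ∈ p.support, x ∈ S → x = v

section

variable {V : Type*} {T : SimpleGraph V} {S : Finset V} {r v w : V}

theorem ExpReach.refl : ExpReach T S r r :=
  ⟨Walk.nil, by simp⟩

theorem ExpReach.concat (hw : ExpReach T S r w) (hS : w ∉ S) (h : T.Adj w v) :
    ExpReach T S r v := by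
  obtain ⟨p, hp⟩ := hw
  refine ⟨p.concat h, fun x hx hxS => ?_⟩
  rw [Walk.support_concat, List.mem_append, List.mem_singleton] at hx
  rcases hx with hx | hx
  · exact absurd (hp x hx hxS ▸ hxS) hS
  · exact hx

theorem SimpleGraph.IsTree.path_eq (hT : T.IsTree) {p q : T.Walk r v} (hp : p.IsPath)
    (hq : q.IsPath) : p = q :=
  congrArg Subtype.val
    ((hT.isAcyclic.subsingleton_path r v).elim (⟨p, hp⟩ : T.Path r v) ⟨q, hq⟩)

theorem SimpleGraph.IsTree.length_eq_dist_of_isPath (hT : T.IsTree) {p : T.Walk r v}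
    (hp : p.IsPath) : p.length = T.dist r v := by
  obtain ⟨q, hq, hl⟩ := hT.connected.exists_path_of_dist r v
  rw [← hl, hT.path_eq hp hq]

theorem ExpReach.exists_isPath (h : ExpReach T S r v) :
    ∃ p : T.Walk r v, p.IsPath ∧ ∀ x ∈ p.support, x ∈ S → x = v := by
  classical
  obtain ⟨p, hp⟩ := h
  exact ⟨p.bypass, p.bypass_isPath, fun x hx => hp x (p.support_bypass_subset_support hx)⟩

theorem ExpReach.expDist_eq (hT : T.IsTree) (h : ExpReach T S r v) :
    expDist T S r v = T.dist r v := by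
  obtain ⟨p, hp, hS⟩ := h.exists_isPath
  refine le_antisymm (sInf_le ⟨p, hS, by rw [hT.length_eq_dist_of_isPath hp]⟩) (le_sInf ?_)
  rintro _ ⟨q, -, rfl⟩
  exact_mod_cast dist_le q

theorem expStep_expDist_of_not_expReach (h : ¬ ExpReach T S r v) :
    expStep (expDist T S r v) = 0 := by
  have : expDist T S r v = ⊤ := by
    rw [expDist, sInf_eq_top]
    rintro _ ⟨q, hq, -⟩
    exact absurd ⟨q, hq⟩ h
  simp [expStep, this]

theorem ExpReach.exists_parent (hT : T.IsTree) (h : ExpReach T S r v) (hv : v ≠ r) :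
    ∃ w, ExpReach T S r w ∧ w ∉ S ∧ T.Adj w v ∧ T.dist r v = T.dist r w + 1 := by
  obtain ⟨p, hp, hS⟩ := h.exists_isPath
  obtain ⟨w, q, e, rfl⟩ : ∃ (w : V) (q : T.Walk r w) (e : T.Adj w v), p = q.concat e := by
    cases p with
    | nil => exact absurd rfl hv
    | cons h p =>
      obtain ⟨w, q, e, he⟩ := Walk.exists_cons_eq_concat h p
      exact ⟨w, q, e, he⟩
  rw [Walk.concat_isPath_iff] at hp
  have hmem : ∀ x ∈ q.support, x ∉ S := fun x hx hxS => by
    have := hS x (by rw [Walk.support_concat]; simp [hx]) hxS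
    exact hp.2 (this ▸ hx)
  refine ⟨w, ⟨q, fun x hx hxS => absurd hxS (hmem x hx)⟩, hmem w q.end_mem_support, e, ?_⟩
  rw [← hT.length_eq_dist_of_isPath hp.1,
    ← hT.length_eq_dist_of_isPath ((Walk.concat_isPath_iff e).2 hp), Walk.length_concat]

theorem SimpleGraph.IsTree.parent_unique (hT : T.IsTree) {w' : V} (h : T.Adj w v)
    (h' : T.Adj w' v) (hd : T.dist r v = T.dist r w + 1) (hd' : T.dist r v = T.dist r w' + 1) :
    w = w' := by
  have key : ∀ {w : V} (h : T.Adj w v), T.dist r v = T.dist r w + 1 →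
      ∃ p : T.Walk r v, p.IsPath ∧ p.penultimate = w := by
    intro w h hd
    obtain ⟨p, -, hl⟩ := hT.connected.exists_path_of_dist r w
    refine ⟨p.concat h, Walk.isPath_of_length_eq_dist _ ?_, Walk.penultimate_concat p h⟩
    rw [Walk.length_concat, hl, hd]
  obtain ⟨p, hp, rfl⟩ := key h hd
  obtain ⟨q, hq, rfl⟩ := key h' hd'
  rw [hT.path_eq hp hq]

/-- A weighted count of the edges of a parent-closed set `F` of vertices of a rooted tree. -/
theorem sum_one_sub_card_children_eq_one [DecidableEq V] [DecidableRel T.Adj] (hT : T.IsTree)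
    {F : Finset V} (hr : r ∈ F)
    (hF : ∀ v ∈ F, v ≠ r → ∃ w ∈ F, T.Adj w v ∧ T.dist r v = T.dist r w + 1) :
    ∑ v ∈ F, (1 - ((F.filter fun w => T.Adj v w ∧ T.dist r w = T.dist r v + 1).card : ℝ) / 2) *
      (1 / 2 : ℝ) ^ T.dist r v = 1 := by
  have hchild : ∑ v ∈ F,
      ((F.filter fun w => T.Adj v w ∧ T.dist r w = T.dist r v + 1).card : ℝ) / 2 *
        (1 / 2 : ℝ) ^ T.dist r v = ∑ w ∈ F.erase r, (1 / 2 : ℝ) ^ T.dist r w := by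
    have hE : F.erase r =
        F.biUnion fun v => F.filter fun w => T.Adj v w ∧ T.dist r w = T.dist r v + 1 := by
      ext w
      simp only [Finset.mem_erase, Finset.mem_biUnion, Finset.mem_filter]
      constructor
      · rintro ⟨hw, hwF⟩
        obtain ⟨v, hv, h⟩ := hF w hwF hw
        exact ⟨v, hv, hwF, h⟩
      · rintro ⟨v, -, hwF, -, h⟩
        refine ⟨?_, hwF⟩
        rintro rfl
        simp at h
    rw [hE, Finset.sum_biUnion]
    · refine Finset.sum_congr rfl fun v _ => ?_
      rw [Finset.sum_congr rfl (g := fun _ => (1 / 2 : ℝ) ^ (T.dist r v + 1))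
        fun w hw => by rw [(Finset.mem_filter.1 hw).2.2]]
      rw [Finset.sum_const, nsmul_eq_mul, pow_succ]
      ring
    · intro a _ b _ hab
      refine Finset.disjoint_left.2 fun w ha hb => hab ?_
      have ha := (Finset.mem_filter.1 ha).2
      have hb := (Finset.mem_filter.1 hb).2
      exact hT.parent_unique ha.1 hb.1 ha.2 hb.2
  simp only [sub_mul, one_mul, Finset.sum_sub_distrib]
  rw [hchild, ← Finset.add_sum_erase F _ hr]
  simp

end

/-- Lemma 6 (equality part): for a binary rooted tree `T` with root `r` and a set
`S` of vertices, `w_{(T,S)}(r) = 2` if and only if `T` contains a full binary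
subtree `F` rooted at `r` (every vertex of `F` other than `r` has its parent in
`F`, and every vertex of `F` has either no child in `F` or exactly two children
in `F`) such that `V(F) ∩ S` is precisely the set of leaves of `F`. -/
theorem expWeight_root_eq_two_iff_full_binary_subtree {V : Type*} [Fintype V]
    [DecidableEq V] (T : SimpleGraph V) [DecidableRel T.Adj] (hT : T.IsTree) (r : V)
    (hbin : ∀ v : V,
      ((T.neighborFinset v).filter fun w => T.dist r w = T.dist r v + 1).card ≤ 2)
    (S : Finset V) :
    expWeight T S r = 2 ↔
      ∃ F : Finset V, r ∈ F ∧
        (∀ v ∈ F, v ≠ r → ∃ w ∈ F, T.Adj w v ∧ T.dist r v = T.dist r w + 1) ∧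
        (∀ v ∈ F,
          (F.filter fun w => T.Adj v w ∧ T.dist r w = T.dist r v + 1).card = 0 ∨
          (F.filter fun w => T.Adj v w ∧ T.dist r w = T.dist r v + 1).card = 2) ∧
        (∀ v ∈ F,
          (v ∈ S ↔ F.filter (fun w => T.Adj v w ∧ T.dist r w = T.dist r v + 1) = ∅)) := by
  classical
  let F₀ : Finset V := Finset.univ.filter fun v => ExpReach T S r v
  have mem₀ : ∀ v, v ∈ F₀ ↔ ExpReach T S r v := fun v => by simp [F₀]
  have hr₀ : r ∈ F₀ := (mem₀ r).2 ExpReach.refl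
  have hparent : ∀ v ∈ F₀, v ≠ r → ∃ w ∈ F₀, T.Adj w v ∧ T.dist r v = T.dist r w + 1 := by
    intro v hv hvr
    obtain ⟨w, hw, -, h⟩ := ((mem₀ v).1 hv).exists_parent hT hvr
    exact ⟨w, (mem₀ w).2 hw, h⟩
  have hle : ∀ (F : Finset V) (v : V),
      F.filter (fun w => T.Adj v w ∧ T.dist r w = T.dist r v + 1) ⊆
        (T.neighborFinset v).filter fun w => T.dist r w = T.dist r v + 1 := by
    intro F v w hw
    have hw := (Finset.mem_filter.1 hw).2
    simpa using hw
  have hleaf : ∀ v ∈ S,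
      F₀.filter (fun w => T.Adj v w ∧ T.dist r w = T.dist r v + 1) = ∅ := by
    intro v hv
    refine Finset.filter_eq_empty_iff.2 fun w hw h => ?_
    have hwr : w ≠ r := by
      rintro rfl
      simp at h
    obtain ⟨u, -, hu, h'⟩ := ((mem₀ w).1 hw).exists_parent hT hwr
    exact hu (hT.parent_unique h'.1 h.1 h'.2 h.2 ▸ hv)
  have hweight : expWeight T S r = 2 * ∑ v ∈ F₀.filter (· ∈ S), (1 / 2 : ℝ) ^ T.dist r v := by
    have hfilter : F₀.filter (· ∈ S) = S.filter fun v => ExpReach T S r v := by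
      ext v
      simp [F₀, and_comm]
    rw [expWeight, hfilter, Finset.sum_filter, Finset.mul_sum]
    refine Finset.sum_congr rfl fun v _ => ?_
    split_ifs with h
    · rw [h.expDist_eq hT, expStep_natCast]
    · rw [expStep_expDist_of_not_expReach h, mul_zero]
  have hiff : expWeight T S r = 2 ↔ ∀ v ∈ F₀, v ∉ S →
      (F₀.filter fun w => T.Adj v w ∧ T.dist r w = T.dist r v + 1).card = 2 := by
    have hsum := sum_one_sub_card_children_eq_one hT hr₀ hparent
    rw [← Finset.sum_filter_add_sum_filter_not F₀ (· ∈ S),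
      Finset.sum_congr rfl (s₁ := F₀.filter (· ∈ S)) (g := fun v => (1 / 2 : ℝ) ^ T.dist r v)
        fun v hv => by rw [hleaf v (Finset.mem_filter.1 hv).2]; simp] at hsum
    have hzero := Finset.sum_eq_zero_iff_of_nonneg (s := F₀.filter fun v => v ∉ S)
      (f := fun v => (1 - ((F₀.filter fun w =>
        T.Adj v w ∧ T.dist r w = T.dist r v + 1).card : ℝ) / 2) * (1 / 2 : ℝ) ^ T.dist r v)
      fun v _ => by
        have h : ((F₀.filter fun w => T.Adj v w ∧ T.dist r w = T.dist r v + 1).card : ℝ) ≤ 2 := by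
          exact_mod_cast (Finset.card_le_card (hle F₀ v)).trans (hbin v)
        exact mul_nonneg (by linarith) (by positivity)
    have hw : expWeight T S r = 2 ↔ ∑ v ∈ F₀.filter (fun v => v ∉ S),
        (1 - ((F₀.filter fun w => T.Adj v w ∧ T.dist r w = T.dist r v + 1).card : ℝ) / 2) *
          (1 / 2 : ℝ) ^ T.dist r v = 0 := by
      rw [hweight]
      constructor <;> intro h <;> linarith
    rw [hw, hzero]
    simp only [Finset.mem_filter, and_imp]
    refine forall₃_congr fun v _ _ => ?_
    rw [mul_eq_zero, or_iff_left (by positivity), sub_eq_zero, eq_comm,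
      div_eq_one_iff_eq two_ne_zero]
    norm_cast
  rw [hiff]
  constructor
  · intro h
    refine ⟨F₀, hr₀, hparent, fun v hv => ?_, fun v hv => ⟨hleaf v, fun he => ?_⟩⟩
    · by_cases hS : v ∈ S
      · exact Or.inl (Finset.card_eq_zero.2 (hleaf v hS))
      · exact Or.inr (h v hv hS)
    · by_contra hS
      have := h v hv hS
      rw [he] at this
      simp at this
  · rintro ⟨F, hr, hpar, hcard, hS⟩
    have hF : F = F₀ := by
      have key : ∀ (n : ℕ) (v : V), T.dist r v = n → (v ∈ F ↔ v ∈ F₀) := by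
        intro n
        induction n with
        | zero =>
          intro v hv
          rw [hT.connected.dist_eq_zero_iff] at hv
          subst hv
          exact iff_of_true hr hr₀
        | succ n ih =>
          intro v hv
          have hvr : v ≠ r := by
            rintro rfl
            simp at hv
          constructor
          · intro hvF
            obtain ⟨w, hw, ha, hd⟩ := hpar v hvF hvr
            have hwS : w ∉ S := fun hwS =>
              Finset.filter_eq_empty_iff.1 ((hS w hw).1 hwS) hvF ⟨ha, hd⟩
            exact (mem₀ v).2 (((mem₀ w).1 ((ih w (by omega)).1 hw)).concat hwS ha)
          · intro hv₀
            obtain ⟨w, hw, hwS, ha, hd⟩ := ((mem₀ v).1 hv₀).exists_parent hT hvr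
            have hwF : w ∈ F := (ih w (by omega)).2 ((mem₀ w).2 hw)
            have hne := mt (hS w hwF).2 hwS
            have h2 := (hcard w hwF).resolve_left (mt Finset.card_eq_zero.1 hne)
            have heq := Finset.eq_of_subset_of_card_le (hle F w) (by rw [h2]; exact hbin w)
            have hvm : v ∈ (T.neighborFinset w).filter fun x => T.dist r x = T.dist r w + 1 := by
              simp [ha, hd]
            rw [← heq] at hvm
            exact (Finset.mem_filter.1 hvm).1
      ext v
      exact key _ v rfl
    subst hF
    intro v hv hvS
    exact (hcard v hv).resolve_left (mt Finset.card_eq_zero.1 (mt (hS v hv).2 hvS))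
end
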